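/- arXiv:1602.07845 — 5 statements merged into one kernel-verified Lean document; each statement's English description precedes it below -/
import Mathlib

section
/- Let n, k be positive integers and let α : Fin n → ℕ be a multi-index with |α| = ∑_i α i ≤ k. Then there exists a {0,1}-valued family δ : (Fin n → Fin k → Bool) → Bool such that for all x : Fin n → ℝ, ∏_{i<n} (x i)^{α i} = ∑_{s with δ s = true} m_s(x), where m_s(x) = ∏_{i<n} ∏_{j<k} (if s i j then x i else 1 − x i). That is, every monomial x^α of order at most k is a sum, with coefficients 0 or 1, of elements of the generator system D_k(x). -/
open Finset

/-- Summing the generators `∏ j, (if s j then y else 1 - y)` over all `s` whose first `a` entries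
are `true` gives `y ^ a`. -/
theorem sum_prod_ite_eq_pow {R : Type*} [CommRing R] {k a : ℕ} (ha : a ≤ k) (y : R) :
    ∑ s ∈ Fintype.piFinset
        (fun j : Fin k => if (j : ℕ) < a then ({true} : Finset Bool) else Finset.univ),
      ∏ j, (if s j then y else 1 - y) = y ^ a := by
  rw [← Finset.prod_univ_sum _ (fun (_ : Fin k) (b : Bool) => if b then y else 1 - y)]
  have factor (j : Fin k) :
      ∑ b ∈ (if (j : ℕ) < a then ({true} : Finset Bool) else Finset.univ),
        (if b then y else 1 - y) = if (j : ℕ) < a then y else 1 := by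
    split_ifs <;> simp
  simp_rw [factor]
  rw [Finset.prod_ite, Finset.prod_const_one, mul_one, Finset.prod_const, Fin.card_filter_val_lt,
    min_eq_right ha]

/-- Every monomial `x^α` of order `|α| ≤ k` is a sum, with coefficients
0 or 1, of elements of the generator system `D_k(x)`, where the elements of
`D_k(x)` are listed by `s : Fin n → Fin k → Bool` via
`m_s(x) = ∏ i, ∏ j, (if s i j then x i else 1 - x i)`. -/
theorem monomial_eq_sum_generator_system
    (n k : ℕ) (hn : 0 < n) (hk : 0 < k) (α : Fin n → ℕ) (hα : ∑ i, α i ≤ k) :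
    ∃ δ : (Fin n → Fin k → Bool) → Bool,
      ∀ x : Fin n → ℝ,
        ∏ i, (x i) ^ (α i) =
          ∑ s ∈ Finset.univ.filter (fun s : Fin n → Fin k → Bool => δ s = true),
            ∏ i, ∏ j, (if s i j then x i else 1 - x i) := by
  let T : Finset (Fin n → Fin k → Bool) := Fintype.piFinset fun i => Fintype.piFinset
    fun j : Fin k => if (j : ℕ) < α i then ({true} : Finset Bool) else Finset.univ
  refine ⟨fun s => decide (s ∈ T), fun x => ?_⟩
  simp only [decide_eq_true_eq, Finset.filter_univ_mem]
  rw [← Finset.prod_univ_sum _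
    (fun (i : Fin n) (t : Fin k → Bool) => ∏ j, if t j then x i else 1 - x i)]
  refine Finset.prod_congr rfl fun i hi => (sum_prod_ite_eq_pow ?_ (x i)).symm
  exact (Finset.single_le_sum (fun _ _ => Nat.zero_le _) hi).trans hα
end

section
/- Let n, k be positive integers and let α : Fin n → ℕ be a multi-index with |α| = ∑_i α i ≤ k. Then there exists a {0,1}-valued family γ : (Fin n → Fin k → Bool) → Bool such that for all x : Fin n → ℝ, 1 − ∏_{i<n} (x i)^{α i} = ∑_{s with γ s = true} m_s(x), where m_s(x) = ∏_{i<n} ∏_{j<k} (if s i j then x i else 1 − x i). That is, 1 − x^α is a sum, with coefficients 0 or 1, of elements of the generator system D_k(x). -/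
open Finset

/-- Summing the generators `m_s(x)` over those `s` whose first `α i` entries in each row `i` are all
`true` gives the monomial `x^α`. -/
lemma sum_generator_eq_monomial {R : Type*} [CommRing R] {n k : ℕ} (α : Fin n → ℕ)
    (hα : ∀ i, α i ≤ k) (x : Fin n → R) :
    ∑ s : Fin n → Fin k → Bool with ∀ i, ∀ j : Fin k, (j : ℕ) < α i → s i j = true,
      ∏ i, ∏ j, (if s i j then x i else 1 - x i) = ∏ i, x i ^ α i := by
  have hset :
      (univ.filter fun s : Fin n → Fin k → Bool =>
        ∀ i, ∀ j : Fin k, (j : ℕ) < α i → s i j = true) =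
      Fintype.piFinset fun i => Fintype.piFinset fun j : Fin k =>
        if (j : ℕ) < α i then {true} else univ := by
    ext s
    simp only [mem_filter, mem_univ, true_and, Fintype.mem_piFinset]
    refine forall₂_congr fun i j => ?_
    split_ifs with h <;> simp [h]
  rw [hset, ← prod_univ_sum (f := fun i (r : Fin k → Bool) => ∏ j, if r j then x i else 1 - x i)]
  refine prod_congr rfl fun i _ => ?_
  rw [← prod_univ_sum (f := fun _ (b : Bool) => if b then x i else 1 - x i)]
  have hfactor (j : Fin k) :
      ∑ b ∈ (if (j : ℕ) < α i then {true} else univ : Finset Bool),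
        (if b then x i else 1 - x i) = if (j : ℕ) < α i then x i else 1 := by
    split_ifs <;> simp
  rw [prod_congr rfl fun j _ => hfactor j]
  simp [prod_ite, Fin.card_filter_val_lt, hα i]

/-- For any monomial `x^α` of order `|α| ≤ k`, the function `1 - x^α`
is a sum, with coefficients 0 or 1, of elements of the generator system `D_k(x)`,
where the elements of `D_k(x)` are listed by `s : Fin n → Fin k → Bool` via
`m_s(x) = ∏ i, ∏ j, (if s i j then x i else 1 - x i)`. -/
theorem one_sub_monomial_eq_sum_generator_system
    (n k : ℕ) (hn : 0 < n) (hk : 0 < k) (α : Fin n → ℕ) (hα : ∑ i, α i ≤ k) :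
    ∃ γ : (Fin n → Fin k → Bool) → Bool,
      ∀ x : Fin n → ℝ,
        1 - ∏ i, (x i) ^ (α i) =
          ∑ s ∈ Finset.univ.filter (fun s : Fin n → Fin k → Bool => γ s = true),
            ∏ i, ∏ j, (if s i j then x i else 1 - x i) := by
  have hle (i : Fin n) : α i ≤ k :=
    (single_le_sum (fun _ _ => Nat.zero_le _) (mem_univ i)).trans hα
  refine ⟨fun s => !decide (∀ i, ∀ j : Fin k, (j : ℕ) < α i → s i j = true), fun x => ?_⟩
  have htotal := sum_generator_eq_monomial (k := k) 0 (fun _ => Nat.zero_le k) x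
  simp only [Pi.zero_apply, not_lt_zero, false_imp_iff, implies_true, filter_true, pow_zero,
    prod_const_one] at htotal
  rw [← sum_generator_eq_monomial α hle x, sub_eq_iff_eq_add']
  simp only [Bool.not_eq_true', decide_eq_false_iff_not]
  rw [sum_filter_add_sum_filter_not, htotal]
end

section
/- (Theorem KRO3, state form.) Let n, k be positive integers, let S = (Fin n → Fin k → Bool), and let a : S → ℝ satisfy 0 ≤ a s ≤ 1 for all s. Define the polynomial function P(x) = ∑_{s ∈ S} a s · m_s(x) for x : Fin n → ℝ. Then there exists a finite family of 2^{nk} × 2^{nk} complex matrices (A_i)_{i ∈ ι} with ∑_i A_iᴴ * A_i = 1 (so that ρ ↦ ∑_i A_i ρ A_iᴴ is a quantum operation in Kraus form) such that for all density matrices σ₁, …, σ_n on ℂ², setting σ = (⊗^k σ₁) ⊗ (⊗^k σ₂) ⊗ ⋯ ⊗ (⊗^k σ_n), one has ∑_i A_i σ A_iᴴ = (1/2^{nk−1}) • (1 : Matrix of size 2^{nk−1}) ⊗ ρ_λ, where λ = P(p(σ₁), …, p(σ_n)) and ρ_λ is the 2×2 diagonal matrix diag(1−λ, λ). -/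
open Matrix Finset Kronecker ComplexOrder

/-- A density matrix on ℂ²: a 2×2 complex matrix that is (Hermitian) positive
semidefinite with trace 1. -/
def IsDensityMatrix2 (ρ : Matrix (Fin 2) (Fin 2) ℂ) : Prop :=
  ρ.PosSemidef ∧ ρ.trace = 1

/-- The probability of truth of a density matrix on ℂ²: `p(ρ) = Re(ρ 1 1)`. -/
noncomputable def probTruth (ρ : Matrix (Fin 2) (Fin 2) ℂ) : ℝ := (ρ 1 1).re

/-- A column-stochastic matrix `w` is realized by a measure-and-prepare quantum operation,
with Kraus operators `√(w r s) • |r⟩⟨s|`. -/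
theorem exists_kraus_of_columnStochastic {I : Type*} [Fintype I] [DecidableEq I]
    (w : I → I → ℝ) (hw : ∀ r s, 0 ≤ w r s) (hsum : ∀ s, ∑ r, w r s = 1) :
    ∃ (m : ℕ) (A : Fin m → Matrix I I ℂ), (∑ i, (A i)ᴴ * A i = 1) ∧
      ∀ ρ : Matrix I I ℂ,
        ∑ i, A i * ρ * (A i)ᴴ = Matrix.diagonal fun r => ∑ s, (w r s : ℂ) * ρ s s := by
  have hsq (r s : I) : ((√(w r s) : ℝ) : ℂ) * ((√(w r s) : ℝ) : ℂ) = (w r s : ℂ) := by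
    rw [← Complex.ofReal_mul, Real.mul_self_sqrt (hw r s)]
  have hsingle (r : I) (f : I → ℂ) :
      Matrix.single r r (∑ s, f s) = ∑ s, Matrix.single r r (f s) :=
    map_sum (Matrix.singleAddMonoidHom r r) f _
  let B : I × I → Matrix I I ℂ := fun q => Matrix.single q.1 q.2 ((√(w q.1 q.2) : ℝ) : ℂ)
  refine ⟨Fintype.card (I × I), fun i => B ((Fintype.equivFin (I × I)).symm i), ?_, fun ρ => ?_⟩
  · rw [(Fintype.equivFin (I × I)).symm.sum_comp (fun q => (B q)ᴴ * B q),
      Fintype.sum_prod_type_right]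
    have hcol (s : I) : ∑ r, (B (r, s))ᴴ * B (r, s) = Matrix.single s s 1 := by
      simp only [B, Matrix.conjTranspose_single, Matrix.single_mul_single_same, RCLike.star_def,
        Complex.conj_ofReal, hsq]
      rw [← hsingle, ← Complex.ofReal_sum, hsum, Complex.ofReal_one]
    simp only [hcol, Matrix.sum_single_one]
  · rw [(Fintype.equivFin (I × I)).symm.sum_comp (fun q => B q * ρ * (B q)ᴴ),
      Fintype.sum_prod_type]
    have hrow (r s : I) : B (r, s) * ρ * (B (r, s))ᴴ = Matrix.single r r ((w r s : ℂ) * ρ s s) := by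
      simp only [B, Matrix.conjTranspose_single, Matrix.single_mul_mul_single, RCLike.star_def,
        Complex.conj_ofReal]
      rw [mul_right_comm, hsq]
    simp only [hrow, ← hsingle]
    exact Matrix.sum_single_eq_diagonal _

theorem IsDensityMatrix2.apply_one_one {ρ : Matrix (Fin 2) (Fin 2) ℂ} (h : IsDensityMatrix2 ρ) :
    ρ 1 1 = (probTruth ρ : ℂ) :=
  (Complex.conj_eq_iff_re.mp (h.1.isHermitian.apply 1 1)).symm

theorem IsDensityMatrix2.apply_zero_zero {ρ : Matrix (Fin 2) (Fin 2) ℂ}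
    (h : IsDensityMatrix2 ρ) : ρ 0 0 = 1 - (probTruth ρ : ℂ) := by
  rw [← h.apply_one_one, eq_sub_iff_add_eq, ← Matrix.trace_fin_two, h.2]

/-- The monomials `∏ i, ∏ j, (if s i j then x i else 1 - x i)` form a partition of unity. -/
theorem sum_prod_prod_ite_eq_one {R : Type*} [CommRing R] {n k : ℕ} (x : Fin n → R) :
    ∑ s : Fin n → Fin k → Bool, ∏ i, ∏ j, (if s i j then x i else 1 - x i) = 1 := by
  rw [← Fintype.prod_sum (fun i (t : Fin k → Bool) => ∏ j, if t j then x i else 1 - x i)]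
  refine Finset.prod_eq_one fun i _ => ?_
  rw [← Fintype.prod_sum (fun (_ : Fin k) (b : Bool) => if b then x i else 1 - x i)]
  simp

/-- The `2 ^ (n * k)` bit strings, viewed as a pair of a string of `n * k - 1` bits and one bit. -/
theorem nonempty_bitStrings_equiv {n k : ℕ} (hn : 0 < n) (hk : 0 < k) :
    Nonempty ((Fin n → Fin k → Bool) ≃ Fin (2 ^ (n * k - 1)) × Fin 2) := by
  refine Fintype.card_eq.mp ?_
  simp only [Fintype.card_pi, Fintype.card_bool, Finset.prod_const, Finset.card_univ,
    Fintype.card_fin, Fintype.card_prod]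
  rw [← pow_mul, mul_comm k n, ← pow_succ, Nat.sub_add_cancel (Nat.mul_pos hn hk)]

/-- Theorem KRO3, state form: given coefficients `a s ∈ [0,1]`
indexed by the generator system `D_k(x)` (i.e. by `s : Fin n → Fin k → Bool`),
there is a quantum operation in Kraus form (a finite family `A_i` of
`2^{nk} × 2^{nk}` matrices with `∑ A_iᴴ A_i = 1`) such that for all density
matrices `σ_1, …, σ_n` on ℂ², applying it to
`σ = (⊗^k σ_1) ⊗ ⋯ ⊗ (⊗^k σ_n)` (whose rows and columns are indexed by
`Fin n → Fin k → Bool`, identified with `Fin (2^(nk-1)) × Fin 2`) yields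
`(1/2^{nk-1}) • I ⊗ ρ_λ` with `λ = P(p(σ_1), …, p(σ_n))`,
where `P(x) = ∑ s, a s * m_s(x)` and `ρ_λ = diag(1-λ, λ)`. -/
theorem polynomial_quantum_operation_state_form
    (n k : ℕ) (hn : 0 < n) (hk : 0 < k)
    (a : (Fin n → Fin k → Bool) → ℝ) (ha : ∀ s, 0 ≤ a s ∧ a s ≤ 1) :
    ∃ (m : ℕ)
      (A : Fin m → Matrix (Fin (2 ^ (n * k - 1)) × Fin 2) (Fin (2 ^ (n * k - 1)) × Fin 2) ℂ)
      (e : (Fin n → Fin k → Bool) ≃ Fin (2 ^ (n * k - 1)) × Fin 2),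
      (∑ i, (A i)ᴴ * A i = 1) ∧
      ∀ σ : Fin n → Matrix (Fin 2) (Fin 2) ℂ, (∀ i, IsDensityMatrix2 (σ i)) →
        ∑ i, A i *
            (Matrix.reindex e e (Matrix.of fun s t : Fin n → Fin k → Bool =>
              ∏ i', ∏ j, σ i' (if s i' j then 1 else 0) (if t i' j then 1 else 0))) *
            (A i)ᴴ
          = ((1 : ℂ) / 2 ^ (n * k - 1)) •
              ((1 : Matrix (Fin (2 ^ (n * k - 1))) (Fin (2 ^ (n * k - 1))) ℂ) ⊗ₖ
                !![1 - (((∑ s : Fin n → Fin k → Bool, a s *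
                    ∏ i', ∏ j, (if s i' j then probTruth (σ i')
                                else 1 - probTruth (σ i'))) : ℝ) : ℂ), 0;
                   0, (((∑ s : Fin n → Fin k → Bool, a s *
                    ∏ i', ∏ j, (if s i' j then probTruth (σ i')
                                else 1 - probTruth (σ i'))) : ℝ) : ℂ)]) := by
  obtain ⟨e⟩ := nonempty_bitStrings_equiv hn hk
  let N : ℝ := 2 ^ (n * k - 1)
  have hN : N ≠ 0 := by positivity
  let w : Fin (2 ^ (n * k - 1)) × Fin 2 → Fin (2 ^ (n * k - 1)) × Fin 2 → ℝ :=
    fun r s => N⁻¹ * ![1 - a (e.symm s), a (e.symm s)] r.2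
  have hw (r s) : 0 ≤ w r s := by
    refine mul_nonneg (by positivity) ?_
    obtain ⟨_, b⟩ := r
    fin_cases b
    · exact sub_nonneg.mpr (ha _).2
    · exact (ha _).1
  have hsum (s) : ∑ r, w r s = 1 := by
    simp only [w, Fintype.sum_prod_type, Fin.sum_univ_two, Matrix.cons_val_zero,
      Matrix.cons_val_one, ← mul_add, sub_add_cancel, mul_one, Finset.sum_const,
      Finset.card_univ, Fintype.card_fin, nsmul_eq_mul, Nat.cast_pow, Nat.cast_ofNat]
    exact mul_inv_cancel₀ hN
  obtain ⟨m, A, hA, hAρ⟩ := exists_kraus_of_columnStochastic w hw hsum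
  refine ⟨m, A, e, hA, fun σ hσ => ?_⟩
  rw [hAρ]
  let M : (Fin n → Fin k → Bool) → ℝ := fun s =>
    ∏ i, ∏ j, if s i j then probTruth (σ i) else 1 - probTruth (σ i)
  have hM : ∑ s, M s = 1 := sum_prod_prod_ite_eq_one _
  have hdiag (s : Fin n → Fin k → Bool) :
      ∏ i, ∏ j, σ i (if s i j then 1 else 0) (if s i j then 1 else 0) = (M s : ℂ) := by
    simp only [M, Complex.ofReal_prod]
    refine Finset.prod_congr rfl fun i _ => Finset.prod_congr rfl fun j _ => ?_
    split_ifs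
    · exact (hσ i).apply_one_one
    · rw [(hσ i).apply_zero_zero, Complex.ofReal_sub, Complex.ofReal_one]
  have hentry (r : Fin (2 ^ (n * k - 1)) × Fin 2) :
      ∑ s, (w r s : ℂ) * (Matrix.reindex e e (Matrix.of fun s t : Fin n → Fin k → Bool =>
        ∏ i, ∏ j, σ i (if s i j then 1 else 0) (if t i j then 1 else 0))) s s
      = ((N⁻¹ * ![1 - ∑ s, a s * M s, ∑ s, a s * M s] r.2 : ℝ) : ℂ) := by
    rw [← e.sum_comp]
    simp only [Matrix.reindex_apply, Matrix.submatrix_apply, Matrix.of_apply,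
      Equiv.symm_apply_apply, hdiag, w, ← Complex.ofReal_mul, ← Complex.ofReal_sum, mul_assoc,
      ← Finset.mul_sum]
    obtain ⟨_, b⟩ := r
    fin_cases b
    · simp [sub_mul, Finset.sum_sub_distrib, hM]
    · simp
  simp only [hentry]
  ext ⟨r, b⟩ ⟨r', b'⟩
  by_cases hr : r = r'
  · subst hr
    fin_cases b <;> fin_cases b' <;> simp [N, M]
  · simp [hr]
end

section
/- (Theorem KRO3, probability form.) Let n, k be positive integers, let S = (Fin n → Fin k → Bool), and let a : S → ℝ satisfy 0 ≤ a s ≤ 1 for all s. Define P(x) = ∑_{s ∈ S} a s · m_s(x). Then there exists a finite family of 2^{nk} × 2^{nk} complex matrices (A_i)_{i ∈ ι} with ∑_i A_iᴴ * A_i = 1 such that for all density matrices σ₁, …, σ_n on ℂ², setting σ = (⊗^k σ₁) ⊗ ⋯ ⊗ (⊗^k σ_n), the probability of truth of the output state satisfies p_{nk}(∑_i A_i σ A_iᴴ) = P(p(σ₁), …, p(σ_n)), where p_m(ρ) = Re tr((I_{2^{m−1}} ⊗ P₁) · ρ) with P₁ = diag(0,1). -/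
open Matrix Finset Kronecker ComplexOrder

/-- The probability of truth of a state on `2^{m-1} · 2` dimensions:
`p_m(ρ) = Re tr((I_{2^{m-1}} ⊗ P₁) ρ)` with `P₁ = diag(0,1)`. -/
noncomputable def probTruthBig (N : ℕ) (ρ : Matrix (Fin N × Fin 2) (Fin N × Fin 2) ℂ) : ℝ :=
  ((((1 : Matrix (Fin N) (Fin N) ℂ) ⊗ₖ !![0, 0; 0, 1]) * ρ).trace).re

/-- The truth probability is the sum of the diagonal entries whose last qubit is `1`. -/
theorem probTruthBig_eq_sum (N : ℕ) (ρ : Matrix (Fin N × Fin 2) (Fin N × Fin 2) ℂ) :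
    probTruthBig N ρ = ∑ x, (ρ (x, 1) (x, 1)).re := by
  simp [probTruthBig, Matrix.trace, Matrix.mul_apply, Fintype.sum_prod_type,
    Matrix.one_apply]

/-- The Kraus operator that measures the basis state `q.1` and prepares `(z, q.2)`, with
amplitude `√(w q.1)` for the truth value `1` and `√(1 - w q.1)` for the truth value `0`. -/
noncomputable def measurePrepareKraus {X Y : Type*} [DecidableEq X] [DecidableEq Y]
    (w : X → ℝ) (z : Y) (q : X × Fin 2) : Matrix (Y × Fin 2) X ℂ :=
  Matrix.single (z, q.2) q.1 ((√(if q.2 = 1 then w q.1 else 1 - w q.1) : ℝ) : ℂ)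

theorem sum_conjTranspose_mul_measurePrepareKraus {X Y : Type*} [Fintype X] [DecidableEq X]
    [Fintype Y] [DecidableEq Y] (w : X → ℝ) (hw : ∀ x, 0 ≤ w x ∧ w x ≤ 1) (z : Y) :
    ∑ q, (measurePrepareKraus w z q)ᴴ * measurePrepareKraus w z q = 1 := by
  have h (x : X) : ((√(1 - w x) : ℝ) : ℂ) * (√(1 - w x) : ℝ) +
      (√(w x) : ℝ) * (√(w x) : ℝ) = 1 := by
    rw [← Complex.ofReal_mul, ← Complex.ofReal_mul, Real.mul_self_sqrt (hw x).1,
      Real.mul_self_sqrt (sub_nonneg.2 (hw x).2)]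
    simp
  simp only [measurePrepareKraus, Matrix.conjTranspose_single, Matrix.single_mul_single_same,
    Fintype.sum_prod_type, Fin.sum_univ_two, ← Matrix.single_add]
  simp [h, Matrix.sum_single_one]

/-- The measure-and-prepare operation outputs truth with probability `∑ x, w x * ρ x x`. -/
theorem probTruthBig_sum_measurePrepareKraus {X : Type*} [Fintype X] [DecidableEq X] {N : ℕ}
    (w : X → ℝ) (hw : ∀ x, 0 ≤ w x) (z : Fin N) (ρ : Matrix X X ℂ) :
    probTruthBig N (∑ q, measurePrepareKraus w z q * ρ * (measurePrepareKraus w z q)ᴴ)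
      = ∑ x, w x * (ρ x x).re := by
  have h (x : X) (c : ℂ) : ((√(w x) : ℝ) : ℂ) * c * (√(w x) : ℝ) = (w x : ℂ) * c := by
    rw [mul_right_comm, ← Complex.ofReal_mul, Real.mul_self_sqrt (hw x)]
  simp only [probTruthBig_eq_sum, measurePrepareKraus, Matrix.conjTranspose_single,
    Matrix.single_mul_mul_single, Matrix.sum_apply, Fintype.sum_prod_type, Fin.sum_univ_two,
    Complex.re_sum]
  rw [Finset.sum_comm]
  simp [Matrix.single_apply, h, apply_ite Complex.re]

theorem IsDensityMatrix2.apply_self {ρ : Matrix (Fin 2) (Fin 2) ℂ} (h : IsDensityMatrix2 ρ)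
    (b : Bool) :
    ρ (if b then 1 else 0) (if b then 1 else 0) =
      ((if b then probTruth ρ else 1 - probTruth ρ : ℝ) : ℂ) := by
  have h1 : ((probTruth ρ : ℝ) : ℂ) = ρ 1 1 := h.1.isHermitian.coe_re_apply_self 1
  have h2 := h.2
  rw [Matrix.trace_fin_two] at h2
  cases b
  · simp [h1, ← h2]
  · simp [h1]

/-- Theorem KRO3, probability form: given coefficients
`a s ∈ [0,1]` indexed by the generator system (i.e. by
`s : Fin n → Fin k → Bool`), there is a finite Kraus family `A_i` of
`2^{nk} × 2^{nk}` matrices with `∑ A_iᴴ A_i = 1` such that, for all density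
matrices `σ_1, …, σ_n` on ℂ² and
`σ = (⊗^k σ_1) ⊗ ⋯ ⊗ (⊗^k σ_n)` (rows and columns indexed by
`Fin n → Fin k → Bool`, identified with `Fin (2^(nk-1)) × Fin 2`), the
probability of truth of the output state `∑ A_i σ A_iᴴ` is
`P(p(σ_1), …, p(σ_n))`, where `P(x) = ∑ s, a s * m_s(x)`. -/
theorem polynomial_quantum_operation_probability_form
    (n k : ℕ) (hn : 0 < n) (hk : 0 < k)
    (a : (Fin n → Fin k → Bool) → ℝ) (ha : ∀ s, 0 ≤ a s ∧ a s ≤ 1) :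
    ∃ (m : ℕ)
      (A : Fin m → Matrix (Fin (2 ^ (n * k - 1)) × Fin 2) (Fin (2 ^ (n * k - 1)) × Fin 2) ℂ)
      (e : (Fin n → Fin k → Bool) ≃ Fin (2 ^ (n * k - 1)) × Fin 2),
      (∑ i, (A i)ᴴ * A i = 1) ∧
      ∀ σ : Fin n → Matrix (Fin 2) (Fin 2) ℂ, (∀ i, IsDensityMatrix2 (σ i)) →
        probTruthBig (2 ^ (n * k - 1))
            (∑ i, A i *
              (Matrix.reindex e e (Matrix.of fun s t : Fin n → Fin k → Bool =>
                ∏ i', ∏ j, σ i' (if s i' j then 1 else 0) (if t i' j then 1 else 0))) *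
              (A i)ᴴ)
          = ∑ s : Fin n → Fin k → Bool, a s *
              ∏ i', ∏ j, (if s i' j then probTruth (σ i') else 1 - probTruth (σ i')) := by
  have hnk : 0 < n * k := Nat.mul_pos hn hk
  have e : (Fin n → Fin k → Bool) ≃ Fin (2 ^ (n * k - 1)) × Fin 2 := by
    refine Fintype.equivOfCardEq ?_
    simp only [Fintype.card_pi, Fintype.card_bool, Fintype.card_prod, Fintype.card_fin,
      Finset.prod_const, Finset.card_univ]
    rw [← pow_mul, mul_comm k n, ← pow_succ, Nat.sub_add_cancel hnk]
  let f := (Fintype.equivFin ((Fin (2 ^ (n * k - 1)) × Fin 2) × Fin 2)).symm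
  let z : Fin (2 ^ (n * k - 1)) := ⟨0, by positivity⟩
  let w : Fin (2 ^ (n * k - 1)) × Fin 2 → ℝ := fun x => a (e.symm x)
  refine ⟨_, fun i => measurePrepareKraus w z (f i), e, ?_, fun σ hσ => ?_⟩
  · rw [f.sum_comp fun q => (measurePrepareKraus w z q)ᴴ * measurePrepareKraus w z q]
    exact sum_conjTranspose_mul_measurePrepareKraus w (fun x => ha _) z
  · rw [f.sum_comp fun q => measurePrepareKraus w z q * _ * (measurePrepareKraus w z q)ᴴ,
      probTruthBig_sum_measurePrepareKraus w (fun x => (ha _).1) z, ← e.sum_comp]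
    refine Finset.sum_congr rfl fun s _ => ?_
    simp only [w, Matrix.reindex_apply, Matrix.submatrix_apply, Equiv.symm_apply_apply,
      Matrix.of_apply, (hσ _).apply_self, ← Complex.ofReal_prod, Complex.ofReal_re]
end

section
/- Let P(x, y) = (5/12)·x(1−x) + (5/12)·y(1−x) + (5/12)·x(1−y) + (5/12)·y(1−y) + (1/2)x + (1/2)y. Then for all real x, y with 0 ≤ x ≤ 1 and 0 ≤ y ≤ 1, the polynomial P approximates the Łukasiewicz conorm with error at most 1/12: |min(1, x + y) − P(x, y)| ≤ 1/12. -/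
/-- the polynomial
`P(x,y) = (5/12)x(1-x) + (5/12)y(1-x) + (5/12)x(1-y) + (5/12)y(1-y) + (1/2)x + (1/2)y`
approximates the Łukasiewicz conorm `min(1, x+y)` within `1/12` on `[0,1]²`. -/
theorem lukasiewicz_conorm_poly_approx
    (x y : ℝ) (hx0 : 0 ≤ x) (hx1 : x ≤ 1) (hy0 : 0 ≤ y) (hy1 : y ≤ 1) :
    |min 1 (x + y) -
      ((5 / 12) * (x * (1 - x)) + (5 / 12) * (y * (1 - x)) +
        (5 / 12) * (x * (1 - y)) + (5 / 12) * (y * (1 - y)) +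
        (1 / 2) * x + (1 / 2) * y)| ≤ 1 / 12 := by
  obtain ⟨s, hs⟩ : ∃ s, s = x + y := ⟨_, rfl⟩
  have hP : (5 / 12) * (x * (1 - x)) + (5 / 12) * (y * (1 - x)) +
      (5 / 12) * (x * (1 - y)) + (5 / 12) * (y * (1 - y)) +
      (1 / 2) * x + (1 / 2) * y = (16 * s - 5 * s ^ 2) / 12 := by
    rw [hs]; ring
  have hs0 : 0 ≤ s := by linarith
  have hs2 : s ≤ 2 := by linarith
  rw [hP, ← hs, abs_le]
  rcases le_total s 1 with h | h
  · rw [min_eq_right h]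
    constructor
    · nlinarith [sq_nonneg (5 * s - 2)]
    · nlinarith [mul_nonneg hs0 (sub_nonneg.2 h)]
  · rw [min_eq_left h]
    constructor
    · nlinarith [sq_nonneg (5 * s - 8)]
    · nlinarith [mul_nonneg (sub_nonneg.2 h) (sub_nonneg.2 hs2)]
end
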